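/- Let k be a field and A, B, C ∈ GL₂(k) invertible 2×2 matrices, and let 𝒜 be the k-subalgebra of M₂(k) generated by A, B, and C. Then 𝒜 ≠ M₂(k) if and only if Δ(A,B) = 0, Δ(B,C) = 0, Δ(C,A) = 0, and Δ(A·B, C) = 0. -/

import Mathlib

/-- The discriminant `Δ(A,B)` of a pair of `2 × 2` matrices. -/
def matrixDisc {R : Type*} [CommRing R] (A B : Matrix (Fin 2) (Fin 2) R) : R :=
  A.trace ^ 2 * B.det + B.trace ^ 2 * A.det + (A * B).trace ^ 2 -
    A.trace * B.trace * (A * B).trace - 4 * A.det * B.det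

open Matrix

section PlaneAlgebras

variable {k : Type*} [Field k]

theorem matrixDisc_eq_neg_det_commutator {R : Type*} [CommRing R]
    (A B : Matrix (Fin 2) (Fin 2) R) : matrixDisc A B = -(A * B - B * A).det := by
  simp only [matrixDisc, det_fin_two, trace_fin_two, mul_apply, Fin.sum_univ_two, Matrix.sub_apply]
  ring

theorem adjoin_eq_top_of_det_commutator_ne_zero {A B : Matrix (Fin 2) (Fin 2) k}
    (h : (A * B - B * A).det ≠ 0) : Algebra.adjoin k {A, B} = ⊤ := by
  have hU : IsUnit (A * B - B * A) := (isUnit_iff_isUnit_det _).2 h.isUnit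
  have hN : A * B - B * A ≠ 0 := by
    intro h0
    simp [h0] at h
  have key : ∀ a b : k, a • (1 : Matrix (Fin 2) (Fin 2) k) + b • A = 0 → a = 0 ∧ b = 0 := by
    intro a b hab
    have hb : b = 0 := by
      have h1 : b • (A * B - B * A) = 0 := by
        have : b • (A * B - B * A) = (a • 1 + b • A) * B - B * (a • 1 + b • A) := by
          simp only [add_mul, mul_add, smul_mul_assoc, mul_smul_comm, one_mul, mul_one, smul_sub]
          abel
        rw [this, hab]
        simp
      exact (smul_eq_zero.1 h1).resolve_right hN
    subst hb
    refine ⟨?_, rfl⟩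
    simpa using hab
  have hli : LinearIndependent k ![1, A, B, A * B] := by
    rw [Fintype.linearIndependent_iff]
    intro g hg
    simp only [Fin.sum_univ_four, cons_val] at hg
    have h1 : (g 2 • (1 : Matrix (Fin 2) (Fin 2) k) + g 3 • A) * (A * B - B * A) = 0 := by
      have : (g 2 • (1 : Matrix (Fin 2) (Fin 2) k) + g 3 • A) * (A * B - B * A) =
          A * (g 0 • 1 + g 1 • A + g 2 • B + g 3 • (A * B)) -
            (g 0 • 1 + g 1 • A + g 2 • B + g 3 • (A * B)) * A := by
        simp only [add_mul, mul_add, smul_mul_assoc, mul_smul_comm, one_mul, mul_one, mul_sub,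
          mul_assoc]
        abel
      rw [this, hg]
      simp
    obtain ⟨h2, h3⟩ := key _ _ (hU.mul_left_eq_zero.1 h1)
    obtain ⟨h0, h1⟩ := key (g 0) (g 1) (by simpa [h2, h3] using hg)
    intro i
    fin_cases i <;> assumption
  have hspan := hli.span_eq_top_of_card_eq_finrank (by simp [Module.finrank_matrix])
  have hA : A ∈ Algebra.adjoin k {A, B} := Algebra.subset_adjoin (by simp)
  have hB : B ∈ Algebra.adjoin k {A, B} := Algebra.subset_adjoin (by simp)
  rw [← Algebra.toSubmodule_eq_top, eq_top_iff, ← hspan, Submodule.span_le]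
  rintro _ ⟨i, rfl⟩
  fin_cases i
  exacts [one_mem (Algebra.adjoin k {A, B}), hA, hB, Subalgebra.mul_mem _ hA hB]

theorem adjoin_ne_top_of_common_eigenvector {s : Set (Matrix (Fin 2) (Fin 2) k)}
    {v : Fin 2 → k} (hv : v ≠ 0) (h : ∀ M ∈ s, ∃ c : k, M *ᵥ v = c • v) :
    Algebra.adjoin k s ≠ ⊤ := by
  intro htop
  have hall : ∀ M : Matrix (Fin 2) (Fin 2) k, ∃ c : k, M *ᵥ v = c • v := by
    intro M
    have hM : M ∈ Algebra.adjoin k s := htop ▸ Algebra.mem_top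
    induction hM using Algebra.adjoin_induction with
    | mem x hx => exact h x hx
    | algebraMap r => exact ⟨r, by simp [Algebra.algebraMap_eq_smul_one, smul_mulVec]⟩
    | add x y _ _ hx hy =>
      obtain ⟨a, ha⟩ := hx
      obtain ⟨b, hb⟩ := hy
      exact ⟨a + b, by rw [add_mulVec, ha, hb, add_smul]⟩
    | mul x y _ _ hx hy =>
      obtain ⟨a, ha⟩ := hx
      obtain ⟨b, hb⟩ := hy
      exact ⟨b * a, by rw [← mulVec_mulVec, hb, mulVec_smul, ha, smul_smul]⟩
  obtain ⟨c, hc⟩ := hall !![0, 1; 0, 0]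
  obtain ⟨d, hd⟩ := hall !![0, 0; 1, 0]
  have c0 := congrFun hc 0
  have c1 := congrFun hc 1
  have d0 := congrFun hd 0
  have d1 := congrFun hd 1
  simp [mulVec, dotProduct, Fin.sum_univ_two] at c0 c1 d0 d1
  apply hv
  ext i
  fin_cases i <;> simp <;> grind

theorem adjoin_pair_ne_top_of_commute {A B : Matrix (Fin 2) (Fin 2) k} (h : A * B = B * A) :
    Algebra.adjoin k {A, B} ≠ ⊤ := by
  intro htop
  have hc : ∀ M N : Matrix (Fin 2) (Fin 2) k, Commute M N := by
    intro M N
    refine Algebra.commute_of_mem_adjoin_of_forall_mem_commute (R := k) (s := {A, B})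
      (htop ▸ Algebra.mem_top) fun x hx => ?_
    refine (Algebra.commute_of_mem_adjoin_of_forall_mem_commute (R := k) (s := {A, B})
      (htop ▸ Algebra.mem_top) fun y hy => ?_).symm
    rcases hx with rfl | rfl <;> rcases hy with rfl | rfl
    exacts [rfl, h, h.symm, rfl]
  have := congrFun (congrFun (hc !![0, 1; 0, 0] !![0, 0; 1, 0]).eq 0) 0
  simp at this

/-- Two vectors of the plane whose determinant vanishes are proportional. -/
theorem exists_smul_eq_of_cross_eq_zero {v w : Fin 2 → k} (hv : v ≠ 0)
    (h : v 0 * w 1 - v 1 * w 0 = 0) : ∃ c : k, w = c • v := by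
  by_cases h0 : v 0 = 0
  · have h1 : v 1 ≠ 0 := fun h1 => hv (by ext i; fin_cases i <;> assumption)
    refine ⟨w 1 / v 1, ?_⟩
    ext i
    fin_cases i <;> simp <;> grind
  · refine ⟨w 0 / v 0, ?_⟩
    ext i
    fin_cases i <;> simp <;> grind

theorem exists_combination_of_cross_ne_zero {v w : Fin 2 → k}
    (h : v 0 * w 1 - v 1 * w 0 ≠ 0) (u : Fin 2 → k) : ∃ p q : k, u = p • v + q • w := by
  refine ⟨(u 0 * w 1 - u 1 * w 0) / (v 0 * w 1 - v 1 * w 0),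
    (v 0 * u 1 - v 1 * u 0) / (v 0 * w 1 - v 1 * w 0), ?_⟩
  ext i
  fin_cases i <;> simp <;> grind

theorem eq_of_mulVec_eq_of_cross_ne_zero {M N : Matrix (Fin 2) (Fin 2) k} {v w : Fin 2 → k}
    (h : v 0 * w 1 - v 1 * w 0 ≠ 0) (hv : M *ᵥ v = N *ᵥ v) (hw : M *ᵥ w = N *ᵥ w) : M = N := by
  refine ext_of_mulVec_single fun i => ?_
  obtain ⟨p, q, hpq⟩ := exists_combination_of_cross_ne_zero h (Pi.single i 1)
  rw [hpq, mulVec_add, mulVec_add, mulVec_smul, mulVec_smul, mulVec_smul, mulVec_smul, hv, hw]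

/-- An eigenvector of a non-scalar `2 × 2` matrix is proportional to one of any two
independent eigenvectors. -/
theorem proportional_of_eigenvectors {M : Matrix (Fin 2) (Fin 2) k}
    (hM : ∀ c : k, M ≠ c • 1) {v w u : Fin 2 → k} {a b c : k}
    (h : v 0 * w 1 - v 1 * w 0 ≠ 0) (hv : M *ᵥ v = a • v) (hw : M *ᵥ w = b • w)
    (hu : M *ᵥ u = c • u) : (∃ p : k, u = p • v) ∨ ∃ q : k, u = q • w := by
  obtain ⟨p, q, rfl⟩ := exists_combination_of_cross_ne_zero h u
  by_cases hp : p = 0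
  · exact Or.inr ⟨q, by simp [hp]⟩
  by_cases hq : q = 0
  · exact Or.inl ⟨p, by simp [hq]⟩
  rw [mulVec_add, mulVec_smul, mulVec_smul, hv, hw] at hu
  have e0 := congrFun hu 0
  have e1 := congrFun hu 1
  simp only [Pi.add_apply, Pi.smul_apply, smul_eq_mul] at e0 e1
  have ha : p * (a - c) * (v 0 * w 1 - v 1 * w 0) = 0 := by
    linear_combination w 1 * e0 - w 0 * e1
  have hb : q * (b - c) * (v 0 * w 1 - v 1 * w 0) = 0 := by
    linear_combination v 0 * e1 - v 1 * e0
  have ha' : a = c := by grind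
  have hb' : b = c := by grind
  exact absurd (eq_of_mulVec_eq_of_cross_ne_zero h (by simp [hv, ha', smul_mulVec])
    (by simp [hw, hb', smul_mulVec])) (hM c)

theorem scalar_or_polynomial_or_common_eigenvector {A B : Matrix (Fin 2) (Fin 2) k}
    (h : matrixDisc A B = 0) :
    (∃ c : k, A = c • 1) ∨ (∃ p q : k, B = p • 1 + q • A) ∨
      ∃ v : Fin 2 → k, v ≠ 0 ∧ (∃ a : k, A *ᵥ v = a • v) ∧ ∃ b : k, B *ᵥ v = b • v := by
  rw [matrixDisc_eq_neg_det_commutator, neg_eq_zero] at h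
  obtain ⟨v, hv, hker⟩ := exists_mulVec_eq_zero_iff.2 h
  rw [sub_mulVec, sub_eq_zero, ← mulVec_mulVec, ← mulVec_mulVec] at hker
  by_cases hA : v 0 * (A *ᵥ v) 1 - v 1 * (A *ᵥ v) 0 = 0
  · obtain ⟨a, ha⟩ := exists_smul_eq_of_cross_eq_zero hv hA
    rw [ha, mulVec_smul] at hker
    by_cases hB : v 0 * (B *ᵥ v) 1 - v 1 * (B *ᵥ v) 0 = 0
    · exact Or.inr (Or.inr ⟨v, hv, ⟨a, ha⟩, exists_smul_eq_of_cross_eq_zero hv hB⟩)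
    · exact Or.inl ⟨a, eq_of_mulVec_eq_of_cross_ne_zero hB (by simpa [smul_mulVec] using ha)
        (by simpa only [smul_mulVec, one_mulVec] using hker)⟩
  · obtain ⟨p, q, hpq⟩ := exists_combination_of_cross_ne_zero hA (B *ᵥ v)
    refine Or.inr (Or.inl ⟨p, q, eq_of_mulVec_eq_of_cross_ne_zero hA ?_ ?_⟩)
    · rw [hpq, add_mulVec, smul_mulVec, smul_mulVec, one_mulVec]
    · rw [← hker, hpq, mulVec_add, mulVec_smul, mulVec_smul, add_mulVec, smul_mulVec, smul_mulVec,
        one_mulVec]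

theorem adjoin_pair_eq_top_iff {A B : Matrix (Fin 2) (Fin 2) k} :
    Algebra.adjoin k {A, B} = ⊤ ↔ matrixDisc A B ≠ 0 := by
  constructor
  · intro htop h
    rcases scalar_or_polynomial_or_common_eigenvector h with
      ⟨c, rfl⟩ | ⟨p, q, rfl⟩ | ⟨v, hv, hA, hB⟩
    · exact adjoin_pair_ne_top_of_commute (by simp) htop
    · exact adjoin_pair_ne_top_of_commute (by simp [mul_add, add_mul]) htop
    · refine adjoin_ne_top_of_common_eigenvector hv ?_ htop
      rintro M (rfl | rfl)
      exacts [hA, hB]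
  · intro h
    rw [matrixDisc_eq_neg_det_commutator, neg_ne_zero] at h
    exact adjoin_eq_top_of_det_commutator_ne_zero h

theorem adjoin_insert_ne_top_of_mem {A B C : Matrix (Fin 2) (Fin 2) k}
    (h : matrixDisc A B = 0) (hC : C ∈ Algebra.adjoin k {A, B}) :
    Algebra.adjoin k {A, B, C} ≠ ⊤ := by
  intro htop
  refine adjoin_pair_eq_top_iff.1 (top_le_iff.1 (htop ▸ Algebra.adjoin_le ?_)) h
  rintro M (rfl | rfl | rfl)
  exacts [Algebra.subset_adjoin (by simp), Algebra.subset_adjoin (by simp), hC]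

/-- Generators of the full matrix algebra with `Δ(A,B) = Δ(B,C) = Δ(C,A) = 0`: the first pair
has a common eigenvector and its first member is not scalar. -/
theorem common_eigenvector_of_adjoin_eq_top {A B C : Matrix (Fin 2) (Fin 2) k}
    (htop : Algebra.adjoin k {A, B, C} = ⊤) (hAB : matrixDisc A B = 0)
    (hBC : matrixDisc B C = 0) (hCA : matrixDisc C A = 0) :
    (∀ c : k, A ≠ c • 1) ∧
      ∃ v : Fin 2 → k, v ≠ 0 ∧ (∃ a : k, A *ᵥ v = a • v) ∧ ∃ b : k, B *ᵥ v = b • v := by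
  have hns : ∀ c : k, A ≠ c • 1 := by
    rintro c rfl
    refine adjoin_insert_ne_top_of_mem hBC (Subalgebra.smul_mem _ (one_mem _) c) ?_
    rw [← htop]
    congr 1
    grind
  refine ⟨hns, ?_⟩
  rcases scalar_or_polynomial_or_common_eigenvector hAB with ⟨c, hc⟩ | ⟨p, q, rfl⟩ | h
  · exact absurd hc (hns c)
  · refine absurd ?_ (adjoin_insert_ne_top_of_mem (C := p • 1 + q • A) hCA
      (add_mem (Subalgebra.smul_mem _ (one_mem _) p)
        (Subalgebra.smul_mem _ (Algebra.subset_adjoin (by simp)) q)))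
    rw [← htop]
    congr 1
    grind
  · exact h

theorem eigenvector_left_of_mul {A B : Matrix (Fin 2) (Fin 2) k} {v : Fin 2 → k} {b s : k}
    (hB : IsUnit B.det) (hv : v ≠ 0) (hb : B *ᵥ v = b • v) (hs : (A * B) *ᵥ v = s • v) :
    ∃ a : k, A *ᵥ v = a • v := by
  have hb0 : b ≠ 0 := by
    rintro rfl
    exact hB.ne_zero (exists_mulVec_eq_zero_iff.1 ⟨v, hv, by simpa using hb⟩)
  rw [← mulVec_mulVec, hb, mulVec_smul] at hs
  exact ⟨b⁻¹ * s, by rw [← smul_smul, ← hs, smul_smul, inv_mul_cancel₀ hb0, one_smul]⟩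

theorem eigenvector_right_of_mul {A B : Matrix (Fin 2) (Fin 2) k} {v : Fin 2 → k} {a s : k}
    (hA : IsUnit A.det) (hv : v ≠ 0) (ha : A *ᵥ v = a • v) (hs : (A * B) *ᵥ v = s • v) :
    ∃ b : k, B *ᵥ v = b • v := by
  have ha0 : a ≠ 0 := by
    rintro rfl
    exact hA.ne_zero (exists_mulVec_eq_zero_iff.1 ⟨v, hv, by simpa using ha⟩)
  refine ⟨a⁻¹ * s, mulVec_injective_iff_isUnit.2 ((isUnit_iff_isUnit_det _).2 hA) ?_⟩
  rw [mulVec_mulVec, hs, mulVec_smul, ha, smul_smul, mul_right_comm, inv_mul_cancel₀ ha0, one_mul]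

theorem matrixDisc_comm {R : Type*} [CommRing R] (A B : Matrix (Fin 2) (Fin 2) R) :
    matrixDisc A B = matrixDisc B A := by
  simp only [matrixDisc, trace_mul_comm A B]
  ring

theorem adjoin_triple_ne_top {A B C : Matrix (Fin 2) (Fin 2) k}
    (hA : IsUnit A.det) (hB : IsUnit B.det) (hAB : matrixDisc A B = 0)
    (hBC : matrixDisc B C = 0) (hCA : matrixDisc C A = 0) (hABC : matrixDisc (A * B) C = 0) :
    Algebra.adjoin k {A, B, C} ≠ ⊤ := by
  intro htop
  have noCommon : ∀ v : Fin 2 → k, v ≠ 0 → (∃ a : k, A *ᵥ v = a • v) →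
      (∃ b : k, B *ᵥ v = b • v) → (∃ c : k, C *ᵥ v = c • v) → False := by
    intro v hv ha hb hc
    refine adjoin_ne_top_of_common_eigenvector hv ?_ htop
    rintro M (rfl | rfl | rfl)
    exacts [ha, hb, hc]
  have htop₁ : Algebra.adjoin k {B, C, A} = ⊤ := by
    rw [← htop]
    congr 1
    grind
  have htop₂ : Algebra.adjoin k {C, A, B} = ⊤ := by
    rw [← htop]
    congr 1
    grind
  obtain ⟨-, v, hv, ⟨b', hvb⟩, c, hvc⟩ := common_eigenvector_of_adjoin_eq_top htop₁ hBC hCA hAB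
  obtain ⟨hC, w, hw, ⟨c', hwc⟩, a', hwa⟩ := common_eigenvector_of_adjoin_eq_top htop₂ hCA hAB hBC
  rw [matrixDisc_comm] at hABC
  rcases scalar_or_polynomial_or_common_eigenvector hABC with
    ⟨c, hc⟩ | ⟨p, q, hpq⟩ | ⟨x, hx, ⟨d, hxc⟩, s, hxs⟩
  · exact hC c hc
  · have hvAB : (A * B) *ᵥ v = (p + q * c) • v := by
      rw [hpq, add_mulVec, smul_mulVec, smul_mulVec, one_mulVec, hvc, smul_smul, add_smul]
    exact noCommon v hv (eigenvector_left_of_mul hB hv hvb hvAB) ⟨b', hvb⟩ ⟨c, hvc⟩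
  · have hvw : v 0 * w 1 - v 1 * w 0 ≠ 0 := by
      intro h
      obtain ⟨r, rfl⟩ := exists_smul_eq_of_cross_eq_zero hv h
      refine noCommon (r • v) hw ⟨a', hwa⟩ ⟨b', ?_⟩ ⟨c', hwc⟩
      rw [mulVec_smul, hvb, smul_comm]
    rcases proportional_of_eigenvectors hC hvw hvc hwc hxc with ⟨r, rfl⟩ | ⟨r, rfl⟩
    · have hxb : B *ᵥ (r • v) = b' • (r • v) := by rw [mulVec_smul, hvb, smul_comm]
      exact noCommon _ hx (eigenvector_left_of_mul hB hx hxb hxs) ⟨b', hxb⟩ ⟨d, hxc⟩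
    · have hxa : A *ᵥ (r • w) = a' • (r • w) := by rw [mulVec_smul, hwa, smul_comm]
      exact noCommon _ hx ⟨a', hxa⟩ (eigenvector_right_of_mul hA hx hxa hxs) ⟨d, hxc⟩

theorem matrixDisc_eq_zero_of_mem {S : Subalgebra k (Matrix (Fin 2) (Fin 2) k)} (hS : S ≠ ⊤)
    {A B : Matrix (Fin 2) (Fin 2) k} (hA : A ∈ S) (hB : B ∈ S) : matrixDisc A B = 0 := by
  by_contra h
  refine hS (top_le_iff.1 ((adjoin_pair_eq_top_iff.2 h) ▸ Algebra.adjoin_le ?_))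
  rintro M (rfl | rfl)
  exacts [hA, hB]

end PlaneAlgebras

/-- For invertible `A, B, C ∈ GL₂(k)`, the subalgebra of `M₂(k)` they generate is proper
iff `Δ(A,B) = Δ(B,C) = Δ(C,A) = 0` and `Δ(A·B, C) = 0`. -/
theorem stmt_18 {k : Type*} [Field k] (A B C : Matrix (Fin 2) (Fin 2) k)
    (hA : IsUnit A.det) (hB : IsUnit B.det) (hC : IsUnit C.det) :
    Algebra.adjoin k {A, B, C} ≠ (⊤ : Subalgebra k (Matrix (Fin 2) (Fin 2) k)) ↔
      matrixDisc A B = 0 ∧ matrixDisc B C = 0 ∧ matrixDisc C A = 0 ∧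
        matrixDisc (A * B) C = 0 := by
  constructor
  · intro h
    have mA : A ∈ Algebra.adjoin k {A, B, C} := Algebra.subset_adjoin (by simp)
    have mB : B ∈ Algebra.adjoin k {A, B, C} := Algebra.subset_adjoin (by simp)
    have mC : C ∈ Algebra.adjoin k {A, B, C} := Algebra.subset_adjoin (by simp)
    exact ⟨matrixDisc_eq_zero_of_mem h mA mB, matrixDisc_eq_zero_of_mem h mB mC,
      matrixDisc_eq_zero_of_mem h mC mA, matrixDisc_eq_zero_of_mem h (mul_mem mA mB) mC⟩
  · rintro ⟨hAB, hBC, hCA, hABC⟩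
    exact adjoin_triple_ne_top hA hB hAB hBC hCA hABC
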